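/- Let (θ₁,θ₂) ∈ Θ with ∫ p_{θ₁,θ₂} dμ = 1. Then ∫ X p_{θ₁,θ₂} dμ is finite if and only if H(p_{θ₁,θ₂}) is finite. In that case the density p_{θ₁,θ₂} is the unique (up to μ-a.e. equality) density attaining the infimum defining F(b) for b := ∫ X p_{θ₁,θ₂} dμ, and F(b) = H(p_{θ₁,θ₂}) = θ₁ + θ₂·b − K(θ₁,θ₂) = θ₂·b − G(θ₂). If moreover H(p_{θ₁,θ₂}) > 0, then b < b₀ when θ₂ < 0 and b > b₀ when θ₂ > 0. -/

import Mathlib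

open MeasureTheory Filter Set Topology
open scoped ENNReal

noncomputable section

variable {Ω : Type*} [MeasurableSpace Ω]

/-- The positive part of an extended real number, as a member of `ℝ≥0∞`. -/
def ePos (x : EReal) : ℝ≥0∞ := if x = ⊤ then ⊤ else ENNReal.ofReal x.toReal

/-- The (signed) integral of an extended-real-valued function: the integral of its
positive part minus the integral of its negative part. -/
def eInt (μ : Measure Ω) (f : Ω → EReal) : EReal :=
  ((∫⁻ r, ePos (f r) ∂μ : ℝ≥0∞) : EReal) - ((∫⁻ r, ePos (-(f r)) ∂μ : ℝ≥0∞) : EReal)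

/-- `p` is a probability density with respect to `μ`. -/
def IsDensity (μ : Measure Ω) (p : Ω → ℝ) : Prop :=
  Measurable p ∧ (∀ r, 0 ≤ p r) ∧ ∫⁻ r, ENNReal.ofReal (p r) ∂μ = 1

/-- `∫ p dμ` for a nonnegative function `p`. -/
def pInt (μ : Measure Ω) (p : Ω → ℝ) : ℝ≥0∞ := ∫⁻ r, ENNReal.ofReal (p r) ∂μ

/-- The convex integral functional `H(p) = ∫ β(r, p(r)) μ(dr)`. -/
def Hfun (μ : Measure Ω) (β : Ω → ℝ → EReal) (p : Ω → ℝ) : EReal :=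
  eInt μ (fun r => β r (p r))

/-- The expected payoff `∫ X p dμ`, as an extended real number. -/
def xInt (μ : Measure Ω) (X p : Ω → ℝ) : EReal :=
  eInt μ (fun r => ((X r * p r : ℝ) : EReal))

/-- The value function `F(b) = inf { H(p) : p density, ∫ X p dμ = b }`. -/
def Ffun (μ : Measure Ω) (β : Ω → ℝ → EReal) (X : Ω → ℝ) (b : ℝ) : EReal :=
  ⨅ p : {p : Ω → ℝ // IsDensity μ p ∧ xInt μ X p = (b : EReal)}, Hfun μ β p.1

/-- The essential infimum `m` of `X`, as an extended real number. -/
def essInfX (μ : Measure Ω) (X : Ω → ℝ) : EReal := essInf (fun r => (X r : EReal)) μ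

/-- The essential supremum `M` of `X`, as an extended real number. -/
def essSupX (μ : Measure Ω) (X : Ω → ℝ) : EReal := essSup (fun r => (X r : EReal)) μ

/-- `k_max = lim_{b ↓ m} F(b)`; since `F` is nonincreasing on `(m, b₀)`, this limit
equals the supremum of `F` over `(m, b₀)`. -/
def kmax (μ : Measure Ω) (β : Ω → ℝ → EReal) (X : Ω → ℝ) (b₀ : ℝ) : EReal :=
  ⨆ b : {b : ℝ // essInfX μ X < (b : EReal) ∧ b < b₀}, Ffun μ β X b

/-- `V(k) = inf { ∫ X p dμ : p density, H(p) ≤ k }`. -/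
def Vfun (μ : Measure Ω) (β : Ω → ℝ → EReal) (X : Ω → ℝ) (k : ℝ) : EReal :=
  ⨅ p : {p : Ω → ℝ // IsDensity μ p ∧ Hfun μ β p ≤ (k : EReal)}, xInt μ X p.1

/-- `W(λ) = inf { ∫ X p dμ + λ H(p) : p density }`. -/
def Wfun (μ : Measure Ω) (β : Ω → ℝ → EReal) (X : Ω → ℝ) (lam : ℝ) : EReal :=
  ⨅ p : {p : Ω → ℝ // IsDensity μ p}, (xInt μ X p.1 + (lam : EReal) * Hfun μ β p.1)

/-- The convex conjugate `β*(r, τ) = sup_s (sτ − β(r,s))` of `β` in its second variable. -/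
def conjβ (β : Ω → ℝ → EReal) (r : Ω) (τ : ℝ) : EReal :=
  ⨆ s : ℝ, (((s * τ : ℝ) : EReal) - β r s)

/-- `K(θ₁, θ₂) = ∫ β*(r, θ₁ + θ₂ X(r)) μ(dr)`. -/
def Kfun (μ : Measure Ω) (β : Ω → ℝ → EReal) (X : Ω → ℝ) (θ₁ θ₂ : ℝ) : EReal :=
  eInt μ (fun r => conjβ β r (θ₁ + θ₂ * X r))

/-- `dom K = {(θ₁, θ₂) : K(θ₁,θ₂) < +∞}`. -/
def domK (μ : Measure Ω) (β : Ω → ℝ → EReal) (X : Ω → ℝ) : Set (ℝ × ℝ) :=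
  {θ : ℝ × ℝ | Kfun μ β X θ.1 θ.2 < ⊤}

/-- `β'(r, +∞) = lim_{s ↑ ∞} β'(r,s)`; by monotonicity of the derivative of a convex
function this equals the supremum of `β'(r, ·)` over `(0, ∞)`. -/
def derivTop (β' : Ω → ℝ → ℝ) (r : Ω) : EReal := ⨆ s : {s : ℝ // 0 < s}, (β' r s.1 : EReal)

/-- `β'(r, 0) = lim_{s ↓ 0} β'(r,s)`, the infimum of `β'(r, ·)` over `(0, ∞)`. -/
def derivZero (β' : Ω → ℝ → ℝ) (r : Ω) : EReal := ⨅ s : {s : ℝ // 0 < s}, (β' r s.1 : EReal)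

/-- The parameter set `Θ`. -/
def ThetaSet (μ : Measure Ω) (β : Ω → ℝ → EReal) (β' : Ω → ℝ → ℝ) (X : Ω → ℝ) :
    Set (ℝ × ℝ) :=
  {θ ∈ domK μ β X | ∀ᵐ r ∂μ, ((θ.1 + θ.2 * X r : ℝ) : EReal) < derivTop β' r}

/-- The generalised exponential family member `p_{θ₁,θ₂}(r) = (β*)'(r, θ₁ + θ₂ X(r))`,
where `ψ` denotes the derivative `(β*)'` of the conjugate in its second variable. -/
def pFam (ψ : Ω → ℝ → ℝ) (X : Ω → ℝ) (θ₁ θ₂ : ℝ) : Ω → ℝ :=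
  fun r => ψ r (θ₁ + θ₂ * X r)

/-- `G(θ₂) = inf_{θ₁} [K(θ₁,θ₂) − θ₁]`. -/
def Gfun (μ : Measure Ω) (β : Ω → ℝ → EReal) (X : Ω → ℝ) (θ₂ : ℝ) : EReal :=
  ⨅ θ₁ : ℝ, (Kfun μ β X θ₁ θ₂ - (θ₁ : EReal))

/-- `Θ₂ = dom G`, the projection of `dom K` to the `θ₂`-axis. -/
def Theta2 (μ : Measure Ω) (β : Ω → ℝ → EReal) (X : Ω → ℝ) : Set ℝ :=
  {θ₂ : ℝ | Gfun μ β X θ₂ < ⊤}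

/-- The Bregman integrand `Δ_β(r, s, t)`; for `t = 0` it is defined as the limit `t ↓ 0`
(with `β'(r,0) = lim_{t↓0} β'(r,t)`), and if `β(r,0) = +∞` then `Δ_β(r,0,0) = 0` and
`Δ_β(r,s,0) = +∞` for `s > 0`. -/
def bregmanInt (β : Ω → ℝ → EReal) (β' : Ω → ℝ → ℝ) (r : Ω) (s t : ℝ) : EReal :=
  if 0 < t then β r s - β r t - ((β' r t : EReal) * ((s - t : ℝ) : EReal))
  else if β r 0 = ⊤ then (if s = 0 then 0 else ⊤)
  else β r s - β r 0 - derivZero β' r * ((s : ℝ) : EReal)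

/-- The (generalised) Bregman distance `B(p, q)`. -/
def Bdist (μ : Measure Ω) (β : Ω → ℝ → EReal) (β' : Ω → ℝ → ℝ) (p q : Ω → ℝ) : EReal :=
  eInt μ (fun r => bregmanInt β β' r (p r) (q r))

/-- The standing assumptions of the framework: `μ` is σ-finite; `β` is a normal convex
integrand (measurable in `r`; equal to `+∞` for `s < 0`; finite, strictly convex and
differentiable with derivative `β'` on `(0,∞)`; right-continuous at `0`); `p₀` is a
density with finite expected payoff `b₀` satisfying `m < b₀ < M`; `H(p₀) = 0 ≤ H(p)`
for every density `p`; and `k_max > 0`. -/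
structure Standing (μ : Measure Ω) (β : Ω → ℝ → EReal) (β' : Ω → ℝ → ℝ)
    (X : Ω → ℝ) (p₀ : Ω → ℝ) (b₀ : ℝ) : Prop where
  sigma : SigmaFinite μ
  betaMeas : ∀ s : ℝ, Measurable (fun r => β r s)
  Xmeas : Measurable X
  betaNeg : ∀ r : Ω, ∀ s : ℝ, s < 0 → β r s = ⊤
  betaNeBot : ∀ r s, β r s ≠ ⊥
  betaFin : ∀ r : Ω, ∀ s : ℝ, 0 < s → β r s ≠ ⊤
  betaZero : ∀ r, Tendsto (fun s => β r s) (𝓝[>] (0:ℝ)) (𝓝 (β r 0))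
  betaConv : ∀ r, StrictConvexOn ℝ (Ioi (0:ℝ)) (fun s => (β r s).toReal)
  betaDeriv : ∀ r : Ω, ∀ s ∈ Ioi (0:ℝ), HasDerivAt (fun t => (β r t).toReal) (β' r s) s
  dens₀ : IsDensity μ p₀
  payoff₀ : xInt μ X p₀ = (b₀ : EReal)
  mlt : essInfX μ X < (b₀ : EReal)
  ltM : (b₀ : EReal) < essSupX μ X
  H₀ : Hfun μ β p₀ = 0
  Hnonneg : ∀ p, IsDensity μ p → 0 ≤ Hfun μ β p
  kmaxPos : 0 < kmax μ β X b₀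

/-- The hypothesis that `ψ = (β*)'`: at every point `τ < β'(r,+∞)`, where the conjugate
`β*(r,·)` is finite and differentiable, `ψ r τ` is its derivative. -/
def IsConjDeriv (β : Ω → ℝ → EReal) (β' : Ω → ℝ → ℝ) (ψ : Ω → ℝ → ℝ) : Prop :=
  ∀ r : Ω, ∀ τ : ℝ, ((τ : ℝ) : EReal) < derivTop β' r →
    HasDerivAt (fun t => (conjβ β r t).toReal) (ψ r τ) τ

/-- `(θ₁, θ₂)` with `θ₂ < 0` attains the double maximum
`max_{θ₂<0} max_{θ₁} (k + K(θ₁,θ₂) − θ₁)/θ₂` (whose value is `V(k)`); such a pair is a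
parameter pair of the worst case localiser `q̂_k = p_{θ₁,θ₂}`. -/
def IsWCLParam (μ : Measure Ω) (β : Ω → ℝ → EReal) (X : Ω → ℝ) (k : ℝ) (θ₁ θ₂ : ℝ) : Prop :=
  θ₂ < 0 ∧ ∀ θ₁' θ₂' : ℝ, θ₂' < 0 →
    ((k : EReal) + Kfun μ β X θ₁' θ₂' - (θ₁' : EReal)) / ((θ₂' : ℝ) : EReal) ≤
      ((k : EReal) + Kfun μ β X θ₁ θ₂ - (θ₁ : EReal)) / ((θ₂ : ℝ) : EReal)

/-- `p` is an (ε-γ)-almost worst case density for threshold `k`. -/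
def AWCD (μ : Measure Ω) (β : Ω → ℝ → EReal) (X : Ω → ℝ) (k ε γ : ℝ) (p : Ω → ℝ) : Prop :=
  IsDensity μ p ∧ Hfun μ β p ≤ ((k + γ : ℝ) : EReal) ∧
    xInt μ X p ≤ Vfun μ β X k + (ε : EReal)

/-- Convergence locally in measure. -/
def TendstoLocallyInMeasure (μ : Measure Ω) (p : ℕ → Ω → ℝ) (q : Ω → ℝ) : Prop :=
  ∀ C : Set Ω, MeasurableSet C → μ C < ⊤ → ∀ ε : ℝ, 0 < ε →
    Tendsto (fun n => μ {r ∈ C | ε < |p n r - q r|}) atTop (𝓝 0)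

end

lemma ePos_eq_toENNReal : ePos = EReal.toENNReal := rfl

section SignedIntegral

variable {Ω : Type*} [MeasurableSpace Ω] {μ : Measure Ω}

lemma eInt_congr {f g : Ω → EReal} (h : f =ᵐ[μ] g) : eInt μ f = eInt μ g := by
  have h1 : ∫⁻ r, ePos (f r) ∂μ = ∫⁻ r, ePos (g r) ∂μ := lintegral_congr_ae (h.fun_comp ePos)
  have h2 : ∫⁻ r, ePos (-f r) ∂μ = ∫⁻ r, ePos (-g r) ∂μ :=
    lintegral_congr_ae (h.fun_comp fun x => ePos (-x))
  rw [eInt, eInt, h1, h2]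

lemma eInt_mono {f g : Ω → EReal} (h : f ≤ᵐ[μ] g) : eInt μ f ≤ eInt μ g := by
  unfold eInt
  simp only [ePos_eq_toENNReal]
  refine EReal.sub_le_sub ?_ ?_ <;> rw [EReal.coe_ennreal_le_coe_ennreal_iff] <;>
    refine lintegral_mono_ae (h.mono fun r hr => EReal.toENNReal_le_toENNReal ?_)
  · exact hr
  · exact EReal.neg_le_neg_iff.2 hr

lemma eInt_coe_of_integrable {f : Ω → ℝ} (hf : Integrable f μ) :
    eInt μ (fun r => (f r : EReal)) = ((∫ r, f r ∂μ : ℝ) : EReal) := by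
  have h1 : ∫⁻ r, ENNReal.ofReal (f r) ∂μ ≠ ⊤ := hf.lintegral_lt_top.ne
  have h2 : ∫⁻ r, ENNReal.ofReal (-f r) ∂μ ≠ ⊤ := hf.neg.lintegral_lt_top.ne
  simp only [eInt, ePos_eq_toENNReal, ← EReal.coe_neg, EReal.real_coe_toENNReal]
  rw [integral_eq_lintegral_pos_part_sub_lintegral_neg_part hf, EReal.coe_sub,
    EReal.coe_ennreal_toReal h1, EReal.coe_ennreal_toReal h2]

/-- A measurable extended-real-valued function with a finite signed integral is a.e. finite
and integrable. -/
lemma integrable_toReal_of_eInt_eq_coe {f : Ω → EReal} (hf : AEMeasurable f μ) {c : ℝ}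
    (h : eInt μ f = (c : EReal)) :
    (∀ᵐ r ∂μ, ((f r).toReal : EReal) = f r) ∧ Integrable (fun r => (f r).toReal) μ ∧
      ∫ r, (f r).toReal ∂μ = c := by
  have h1 : ∫⁻ r, (f r).toENNReal ∂μ ≠ ⊤ := by
    intro h1
    simp only [eInt, ePos_eq_toENNReal, h1, EReal.coe_ennreal_top] at h
    generalize ((∫⁻ r, (-f r).toENNReal ∂μ : ℝ≥0∞) : EReal) = x at h
    induction x <;> simp at h
  have h2 : ∫⁻ r, (-f r).toENNReal ∂μ ≠ ⊤ := by
    intro h2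
    simp only [eInt, ePos_eq_toENNReal, h2, EReal.coe_ennreal_top] at h
    simp at h
  have hfin : ∀ᵐ r ∂μ, ((f r).toReal : EReal) = f r := by
    filter_upwards [ae_lt_top' hf.ereal_toENNReal h1, ae_lt_top' hf.neg.ereal_toENNReal h2]
      with r hr1 hr2
    have ht := EReal.toENNReal_ne_top_iff.1 hr1.ne
    have hb := EReal.toENNReal_ne_top_iff.1 hr2.ne
    exact EReal.coe_toReal ht (by simpa using hb)
  have hint : Integrable (fun r => (f r).toReal) μ := by
    refine ⟨(measurable_ereal_toReal.comp_aemeasurable hf).aestronglyMeasurable, ?_⟩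
    rw [hasFiniteIntegral_iff_norm]
    calc ∫⁻ r, ENNReal.ofReal ‖(f r).toReal‖ ∂μ
        ≤ ∫⁻ r, ((f r).toENNReal + (-f r).toENNReal) ∂μ := by
          refine lintegral_mono_ae (hfin.mono fun r hr => ?_)
          rw [← hr, ← EReal.coe_neg]
          simp only [EReal.real_coe_toENNReal, EReal.toReal_coe, Real.norm_eq_abs]
          rcases le_total 0 (f r).toReal with h0 | h0
          · rw [abs_of_nonneg h0]; exact le_self_add
          · rw [abs_of_nonpos h0]; exact le_add_self
      _ = _ := lintegral_add_left' hf.ereal_toENNReal _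
      _ < ⊤ := by simp [lt_top_iff_ne_top, h1, h2]
  refine ⟨hfin, hint, ?_⟩
  have := eInt_coe_of_integrable hint
  rw [eInt_congr (hfin : (fun r => ((f r).toReal : EReal)) =ᵐ[μ] f), h] at this
  exact_mod_cast this.symm

lemma IsDensity.integrable {p : Ω → ℝ} (hp : IsDensity μ p) :
    Integrable p μ ∧ ∫ r, p r ∂μ = 1 := by
  obtain ⟨hm, h0, h1⟩ := hp
  refine ⟨⟨hm.aestronglyMeasurable, ?_⟩, ?_⟩
  · rw [hasFiniteIntegral_iff_ofReal (Eventually.of_forall h0), h1]; simp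
  · rw [integral_eq_lintegral_of_nonneg_ae (Eventually.of_forall h0) hm.aestronglyMeasurable, h1]
    simp

lemma IsDensity.integrable_mul {X p : Ω → ℝ} (hX : Measurable X) (hp : IsDensity μ p) {b : ℝ}
    (hb : xInt μ X p = (b : EReal)) :
    Integrable (fun r => X r * p r) μ ∧ ∫ r, X r * p r ∂μ = b := by
  have := integrable_toReal_of_eInt_eq_coe
    (measurable_coe_real_ereal.comp (hX.mul hp.1)).aemeasurable hb
  exact this.2

end SignedIntegral

section ConvexIntegrand

variable {Ω : Type*} [MeasurableSpace Ω] {μ : Measure Ω} {β : Ω → ℝ → EReal}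
  {β' ψ : Ω → ℝ → ℝ} {X p₀ : Ω → ℝ} {b₀ : ℝ}

lemma Standing.continuousOn (hst : Standing μ β β' X p₀ b₀) (r : Ω) :
    ContinuousOn (β r) (Ici 0) := by
  intro s hs
  rcases eq_or_lt_of_le (mem_Ici.1 hs) with rfl | hs
  · rw [← continuousWithinAt_Ioi_iff_Ici]
    exact hst.betaZero r
  · have h : ContinuousAt (fun t => ((β r t).toReal : EReal)) s :=
      continuous_coe_real_ereal.continuousAt.comp (hst.betaDeriv r s hs).continuousAt
    refine (h.congr ?_).continuousWithinAt
    filter_upwards [lt_mem_nhds hs] with t ht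
    exact EReal.coe_toReal (hst.betaFin r t ht) (hst.betaNeBot r t)

/-- A normal integrand composed with a nonnegative measurable function is measurable. -/
lemma Standing.measurable_comp (hst : Standing μ β β' X p₀ b₀) {p : Ω → ℝ} (hp : Measurable p)
    (hp0 : ∀ r, 0 ≤ p r) : Measurable (fun r => β r (p r)) := by
  let q : ℕ → Ω → ℝ := fun n r => ((⌊((n : ℝ) + 1) * p r⌋₊ : ℝ) + 1) / ((n : ℝ) + 1)
  have hq0 (n r) : 0 ≤ q n r := by positivity
  have hlow (n r) : p r ≤ q n r := by
    rw [le_div_iff₀ (by positivity), mul_comm]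
    exact (Nat.lt_floor_add_one _).le
  have hupp (n r) : q n r ≤ p r + 1 / ((n : ℝ) + 1) := by
    have hn : (0 : ℝ) < (n : ℝ) + 1 := by positivity
    have := Nat.floor_le (mul_nonneg hn.le (hp0 r))
    rw [div_le_iff₀ hn, add_mul (p r), div_mul_cancel₀ _ hn.ne']
    linarith
  have hlim (r) : Tendsto (fun n => q n r) atTop (𝓝 (p r)) := by
    refine tendsto_of_tendsto_of_tendsto_of_le_of_le tendsto_const_nhds ?_
      (fun n => hlow n r) (fun n => hupp n r)
    simpa using tendsto_const_nhds.add (tendsto_one_div_add_atTop_nhds_zero_nat (𝕜 := ℝ))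
  refine measurable_of_tendsto_metrizable (f := fun n r => β r (q n r)) (fun n => ?_) ?_
  · have hF : Measurable (fun x : ℕ × Ω => β x.2 (((x.1 : ℝ) + 1) / ((n : ℝ) + 1))) :=
      measurable_from_prod_countable_right fun k =>
        hst.betaMeas (((k : ℝ) + 1) / ((n : ℝ) + 1))
    exact hF.comp
      ((Nat.measurable_floor.comp (measurable_const.mul hp)).prodMk measurable_id)
  · refine tendsto_pi_nhds.2 fun r => (hst.continuousOn r (p r) (hp0 r)).tendsto.comp ?_
    exact tendsto_nhdsWithin_iff.2 ⟨hlim r, Eventually.of_forall fun n => hq0 n r⟩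

/-- Below `β'(r, +∞)` the supremum defining the conjugate is attained. -/
lemma Standing.exists_isMax (hst : Standing μ β β' X p₀ b₀) {r : Ω} {τ : ℝ}
    (hτ : (τ : EReal) < derivTop β' r) :
    ∃ s : ℝ, β r s ≠ ⊤ ∧ ∀ u : ℝ, ((u * τ : ℝ) : EReal) - β r u ≤ ((s * τ : ℝ) : EReal) - β r s := by
  obtain ⟨⟨s₁, hs₁⟩, h₁⟩ := lt_iSup_iff.1 hτ
  replace h₁ : τ < β' r s₁ := EReal.coe_lt_coe_iff.1 h₁
  have hcont : ContinuousOn (fun u : ℝ => ((u * τ : ℝ) : EReal) - β r u) (Icc 0 s₁) := by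
    intro u hu
    have h1 : ContinuousWithinAt (fun u : ℝ => ((u * τ : ℝ) : EReal)) (Icc 0 s₁) u :=
      (continuous_coe_real_ereal.comp (continuous_mul_const τ)).continuousWithinAt
    have h2 : ContinuousWithinAt (fun u => -β r u) (Icc 0 s₁) u :=
      continuous_neg.continuousAt.comp_continuousWithinAt
        ((hst.continuousOn r u hu.1).mono Icc_subset_Ici_self)
    have h3 : ContinuousAt (fun p : EReal × EReal => p.1 + p.2) (((u * τ : ℝ) : EReal), -β r u) :=
      EReal.continuousAt_add (Or.inl (EReal.coe_ne_top _)) (Or.inl (EReal.coe_ne_bot _))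
    exact h3.comp_continuousWithinAt (f := fun u => (((u * τ : ℝ) : EReal), -β r u)) (h1.prodMk h2)
  obtain ⟨s, -, hmax⟩ := isCompact_Icc.exists_isMaxOn (nonempty_Icc.2 hs₁.le) hcont
  have hmax₁ : ((s₁ * τ : ℝ) : EReal) - β r s₁ ≤ ((s * τ : ℝ) : EReal) - β r s :=
    hmax (right_mem_Icc.2 hs₁.le)
  have hfin (u : ℝ) (hu : 0 < u) : ((β r u).toReal : EReal) = β r u :=
    EReal.coe_toReal (hst.betaFin r u hu) (hst.betaNeBot r u)
  refine ⟨s, fun hs => ?_, fun u => ?_⟩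
  · rw [hs, ← hfin s₁ hs₁, ← EReal.coe_sub, EReal.sub_top] at hmax₁
    exact EReal.coe_ne_bot _ (le_bot_iff.1 hmax₁)
  · rcases lt_or_ge u 0 with hu | hu
    · simp [hst.betaNeg r u hu]
    rcases le_or_gt u s₁ with hu₁ | hu₁
    · exact hmax ⟨hu, hu₁⟩
    refine le_trans ?_ hmax₁
    have hu0 : 0 < u := hs₁.trans hu₁
    have hslope := (hst.betaConv r).convexOn.le_slope_of_hasDerivAt hs₁ hu0 hu₁
      (hst.betaDeriv r s₁ hs₁)
    rw [slope_def_field, le_div_iff₀ (sub_pos.2 hu₁)] at hslope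
    change _ ≤ ((s₁ * τ : ℝ) : EReal) - β r s₁
    rw [← hfin u hu0, ← hfin s₁ hs₁, ← EReal.coe_sub, ← EReal.coe_sub, EReal.coe_le_coe_iff]
    nlinarith

/-- Fenchel equality at the derivative of the conjugate, with uniqueness of the maximiser. -/
lemma Standing.conjβ_eq (hst : Standing μ β β' X p₀ b₀) (hψ : IsConjDeriv β β' ψ) {r : Ω} {τ : ℝ}
    (hτ : (τ : EReal) < derivTop β' r) :
    β r (ψ r τ) ≠ ⊤ ∧ conjβ β r τ = ((ψ r τ * τ : ℝ) : EReal) - β r (ψ r τ) ∧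
      ∀ s : ℝ, conjβ β r τ = ((s * τ : ℝ) : EReal) - β r s → s = ψ r τ := by
  have hreal {s : ℝ} (hs : β r s ≠ ⊤) (t : ℝ) :
      ((s * t : ℝ) : EReal) - β r s = ((s * t - (β r s).toReal : ℝ) : EReal) := by
    rw [EReal.coe_sub, EReal.coe_toReal hs (hst.betaNeBot r s)]
  have hmax {t : ℝ} (ht : (t : EReal) < derivTop β' r) :
      ∃ s : ℝ, β r s ≠ ⊤ ∧ conjβ β r t = ((s * t : ℝ) : EReal) - β r s := by
    obtain ⟨s, hs, h⟩ := hst.exists_isMax ht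
    exact ⟨s, hs, le_antisymm (iSup_le h) (le_iSup (fun s : ℝ => ((s * t : ℝ) : EReal) - β r s) s)⟩
  have huniq (s : ℝ) (hs : β r s ≠ ⊤) (h : conjβ β r τ = ((s * τ : ℝ) : EReal) - β r s) :
      s = ψ r τ := by
    have hd : HasDerivAt (fun t => (conjβ β r t).toReal - s * t) (ψ r τ - s * 1) τ :=
      (hψ r τ hτ).sub ((hasDerivAt_id τ).const_mul s)
    have hmin : IsLocalMin (fun t => (conjβ β r t).toReal - s * t) τ := by
      have hnear : ∀ᶠ t : ℝ in 𝓝 τ, (t : EReal) < derivTop β' r :=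
        continuous_coe_real_ereal.continuousAt.eventually (gt_mem_nhds hτ)
      filter_upwards [hnear] with t ht
      obtain ⟨s', hs', h'⟩ := hmax ht
      have hle : ((s * t : ℝ) : EReal) - β r s ≤ conjβ β r t :=
        le_iSup (fun s : ℝ => ((s * t : ℝ) : EReal) - β r s) s
      rw [h', hreal hs, hreal hs', EReal.coe_le_coe_iff] at hle
      rw [h, h', hreal hs, hreal hs', EReal.toReal_coe, EReal.toReal_coe]
      linarith
    have := hmin.hasDerivAt_eq_zero hd
    linarith
  obtain ⟨s, hs, h⟩ := hmax hτ
  have hsψ := huniq s hs h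
  subst hsψ
  refine ⟨hs, h, fun s' h' => huniq s' (fun hs' => ?_) h'⟩
  rw [h', hs', EReal.sub_top, hreal hs] at h
  exact EReal.coe_ne_bot _ h.symm

lemma Standing.exists_Hfun_eq_coe (hst : Standing μ β β' X p₀ b₀) {p : Ω → ℝ} (hp : IsDensity μ p)
    (h : Hfun μ β p ≠ ⊤) : ∃ c : ℝ, Hfun μ β p = (c : EReal) :=
  ⟨_, (EReal.coe_toReal h (EReal.bot_lt_zero.trans_le (hst.Hnonneg p hp)).ne').symm⟩

/-- The Fenchel minorant of `β*(r, θ₁ + θ₂ X(r))` given by a density with finite payoff and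
finite `H` is integrable, with integral `θ₁ + θ₂ b - h`. -/
lemma Standing.fenchel_minorant (hst : Standing μ β β' X p₀ b₀) {p : Ω → ℝ} (hp : IsDensity μ p)
    {b h : ℝ} (hb : xInt μ X p = (b : EReal)) (hh : Hfun μ β p = (h : EReal)) (θ₁ θ₂ : ℝ) :
    Integrable (fun r => p r * (θ₁ + θ₂ * X r) - (β r (p r)).toReal) μ ∧
      ∫ r, (p r * (θ₁ + θ₂ * X r) - (β r (p r)).toReal) ∂μ = θ₁ + θ₂ * b - h ∧
      ∀ᵐ r ∂μ, ((p r * (θ₁ + θ₂ * X r) - (β r (p r)).toReal : ℝ) : EReal) =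
        ((p r * (θ₁ + θ₂ * X r) : ℝ) : EReal) - β r (p r) := by
  obtain ⟨hpi, hp1⟩ := hp.integrable
  obtain ⟨hXi, hXb⟩ := hp.integrable_mul hst.Xmeas hb
  obtain ⟨hfin, hβi, hβh⟩ :=
    integrable_toReal_of_eInt_eq_coe (hst.measurable_comp hp.1 hp.2.1).aemeasurable hh
  have heq : (fun r => p r * (θ₁ + θ₂ * X r) - (β r (p r)).toReal) =
      fun r => θ₁ * p r + θ₂ * (X r * p r) - (β r (p r)).toReal := by
    funext r; ring
  have hpX : Integrable (fun r => θ₁ * p r + θ₂ * (X r * p r)) μ :=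
    (hpi.const_mul θ₁).add (hXi.const_mul θ₂)
  refine ⟨?_, ?_, hfin.mono fun r hr => ?_⟩
  · rw [heq]
    exact hpX.sub hβi
  · rw [heq, integral_sub hpX hβi,
      integral_add (hpi.const_mul θ₁) (hXi.const_mul θ₂), integral_const_mul, integral_const_mul,
      hp1, hXb, hβh, mul_one]
  · rw [EReal.coe_sub, hr]

lemma Standing.le_Kfun (hst : Standing μ β β' X p₀ b₀) {p : Ω → ℝ} (hp : IsDensity μ p)
    {b h : ℝ} (hb : xInt μ X p = (b : EReal)) (hh : Hfun μ β p = (h : EReal)) (θ₁ θ₂ : ℝ) :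
    ((θ₁ + θ₂ * b - h : ℝ) : EReal) ≤ Kfun μ β X θ₁ θ₂ := by
  obtain ⟨hi, hint, hae⟩ := hst.fenchel_minorant hp hb hh θ₁ θ₂
  rw [← hint, ← eInt_coe_of_integrable hi]
  refine eInt_mono (hae.mono fun r hr => ?_)
  exact hr.trans_le <| le_iSup (fun s : ℝ => ((s * (θ₁ + θ₂ * X r) : ℝ) : EReal) - β r s) (p r)

lemma Standing.exists_Kfun_eq_coe (hst : Standing μ β β' X p₀ b₀) {θ₁ θ₂ : ℝ}
    (hK : Kfun μ β X θ₁ θ₂ < ⊤) : ∃ κ : ℝ, Kfun μ β X θ₁ θ₂ = (κ : EReal) :=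
  ⟨_, (EReal.coe_toReal hK.ne ((EReal.bot_lt_coe _).trans_le
    (hst.le_Kfun hst.dens₀ hst.payoff₀ (h := 0) (by simpa using hst.H₀) θ₁ θ₂)).ne').symm⟩

/-- For a parameter in `Θ` whose family member `q` is a density, `β(r, q(r))` is a.e. finite and
`q τ - β(·, q)`, with `τ = θ₁ + θ₂ X`, is integrable with integral `K(θ₁, θ₂)`. -/
lemma Standing.pFam_fenchel_eq (hst : Standing μ β β' X p₀ b₀) (hψ : IsConjDeriv β β' ψ)
    {θ₁ θ₂ κ : ℝ} (hθ : (θ₁, θ₂) ∈ ThetaSet μ β β' X) (hq : IsDensity μ (pFam ψ X θ₁ θ₂))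
    (hκ : Kfun μ β X θ₁ θ₂ = (κ : EReal)) :
    let q := pFam ψ X θ₁ θ₂
    let k := fun r => q r * (θ₁ + θ₂ * X r) - (β r (q r)).toReal
    (∀ᵐ r ∂μ, ((β r (q r)).toReal : EReal) = β r (q r)) ∧
      (∀ᵐ r ∂μ, conjβ β r (θ₁ + θ₂ * X r) = (k r : EReal)) ∧
      Integrable k μ ∧ ∫ r, k r ∂μ = κ := by
  intro q k
  have hfin : ∀ᵐ r ∂μ, ((β r (q r)).toReal : EReal) = β r (q r) := by
    filter_upwards [hθ.2] with r hr
    exact EReal.coe_toReal (hst.conjβ_eq hψ hr).1 (hst.betaNeBot r _)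
  have hconj : ∀ᵐ r ∂μ, conjβ β r (θ₁ + θ₂ * X r) = (k r : EReal) := by
    filter_upwards [hθ.2, hfin] with r hr hf
    rw [EReal.coe_sub, hf]
    exact (hst.conjβ_eq hψ hr).2.1
  have hkm : Measurable k :=
    (hq.1.mul (measurable_const.add (measurable_const.mul hst.Xmeas))).sub
      (measurable_ereal_toReal.comp (hst.measurable_comp hq.1 hq.2.1))
  have hk : eInt μ (fun r => (k r : EReal)) = (κ : EReal) := by
    rw [← hκ]
    exact (eInt_congr hconj).symm
  exact ⟨hfin, hconj, (integrable_toReal_of_eInt_eq_coe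
    (measurable_coe_real_ereal.comp hkm).aemeasurable hk).2⟩

/-- A density attaining equality in the integrated Fenchel inequality is the family member. -/
lemma Standing.ae_eq_pFam (hst : Standing μ β β' X p₀ b₀) (hψ : IsConjDeriv β β' ψ)
    {θ₁ θ₂ κ : ℝ} (hθ : (θ₁, θ₂) ∈ ThetaSet μ β β' X) (hq : IsDensity μ (pFam ψ X θ₁ θ₂))
    (hκ : Kfun μ β X θ₁ θ₂ = (κ : EReal)) {p : Ω → ℝ} (hp : IsDensity μ p) {b : ℝ}
    (hb : xInt μ X p = (b : EReal))
    (hh : Hfun μ β p = ((θ₁ + θ₂ * b - κ : ℝ) : EReal)) : p =ᵐ[μ] pFam ψ X θ₁ θ₂ := by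
  obtain ⟨-, hconj, hki, hkκ⟩ := hst.pFam_fenchel_eq hψ hθ hq hκ
  obtain ⟨hui, huκ, hu⟩ := hst.fenchel_minorant hp hb hh θ₁ θ₂
  have hle : (fun r => p r * (θ₁ + θ₂ * X r) - (β r (p r)).toReal) ≤ᵐ[μ]
      fun r => pFam ψ X θ₁ θ₂ r * (θ₁ + θ₂ * X r) - (β r (pFam ψ X θ₁ θ₂ r)).toReal := by
    filter_upwards [hconj, hu] with r hr hur
    rw [← EReal.coe_le_coe_iff, ← hr, hur]
    exact le_iSup (fun s : ℝ => ((s * (θ₁ + θ₂ * X r) : ℝ) : EReal) - β r s) (p r)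
  have heq := (integral_eq_iff_of_ae_le hui hki hle).1 (by rw [huκ, hkκ]; ring)
  filter_upwards [hθ.2, hconj, hu, heq] with r hr hc hur he
  refine (hst.conjβ_eq hψ hr).2.2 (p r) ?_
  rw [hc, ← hur, he]

lemma Standing.Hfun_pFam (hst : Standing μ β β' X p₀ b₀) (hψ : IsConjDeriv β β' ψ)
    {θ₁ θ₂ κ : ℝ} (hθ : (θ₁, θ₂) ∈ ThetaSet μ β β' X) (hq : IsDensity μ (pFam ψ X θ₁ θ₂))
    (hκ : Kfun μ β X θ₁ θ₂ = (κ : EReal)) {b : ℝ}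
    (hb : xInt μ X (pFam ψ X θ₁ θ₂) = (b : EReal)) :
    Hfun μ β (pFam ψ X θ₁ θ₂) = ((θ₁ + θ₂ * b - κ : ℝ) : EReal) := by
  obtain ⟨hfin, -, hki, hkκ⟩ := hst.pFam_fenchel_eq hψ hθ hq hκ
  have hH : Hfun μ β (pFam ψ X θ₁ θ₂) =
      eInt μ (fun r => ((β r (pFam ψ X θ₁ θ₂ r)).toReal : EReal)) :=
    eInt_congr (hfin.mono fun r hr => hr.symm)
  obtain ⟨hqi, hq1⟩ := hq.integrable
  obtain ⟨hXi, hXb⟩ := hq.integrable_mul hst.Xmeas hb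
  generalize pFam ψ X θ₁ θ₂ = q at *
  have hqX : Integrable (fun r => θ₁ * q r + θ₂ * (X r * q r)) μ :=
    (hqi.const_mul θ₁).add (hXi.const_mul θ₂)
  have heq : (fun r => (β r (q r)).toReal) = fun r => (θ₁ * q r + θ₂ * (X r * q r)) -
      (q r * (θ₁ + θ₂ * X r) - (β r (q r)).toReal) := by
    funext r; ring
  have hi : Integrable (fun r => (β r (q r)).toReal) μ := by
    rw [heq]; exact hqX.sub hki
  rw [hH, eInt_coe_of_integrable hi, heq, integral_sub hqX hki,
    integral_add (hqi.const_mul θ₁) (hXi.const_mul θ₂), integral_const_mul, integral_const_mul,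
    hq1, hXb, hkκ, mul_one]

lemma Standing.exists_xInt_pFam (hst : Standing μ β β' X p₀ b₀) (hψ : IsConjDeriv β β' ψ)
    {θ₁ θ₂ κ h : ℝ} (hθ : (θ₁, θ₂) ∈ ThetaSet μ β β' X) (hq : IsDensity μ (pFam ψ X θ₁ θ₂))
    (hκ : Kfun μ β X θ₁ θ₂ = (κ : EReal)) (hh : Hfun μ β (pFam ψ X θ₁ θ₂) = (h : EReal)) :
    ∃ b : ℝ, xInt μ X (pFam ψ X θ₁ θ₂) = (b : EReal) := by
  have hH₀ : Hfun μ β p₀ = ((0 : ℝ) : EReal) := by simpa using hst.H₀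
  obtain ⟨-, -, hki, hkκ⟩ := hst.pFam_fenchel_eq hψ hθ hq hκ
  obtain ⟨hqi, hq1⟩ := hq.integrable
  obtain ⟨-, hai, hah⟩ :=
    integrable_toReal_of_eInt_eq_coe (hst.measurable_comp hq.1 hq.2.1).aemeasurable hh
  rcases eq_or_ne θ₂ 0 with rfl | hθ₂
  · have hh0 : 0 ≤ h := by
      have := hst.Hnonneg _ hq
      rw [hh] at this
      exact_mod_cast this
    have hle := hst.le_Kfun hst.dens₀ hst.payoff₀ hH₀ θ₁ 0
    rw [hκ, EReal.coe_le_coe_iff] at hle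
    have hκh : κ = θ₁ - h := by
      simp only [zero_mul, add_zero] at hkκ
      rw [integral_sub (hqi.mul_const θ₁) hai, integral_mul_const, hq1, hah] at hkκ
      linarith
    have hp₀ : p₀ =ᵐ[μ] pFam ψ X θ₁ 0 := by
      refine hst.ae_eq_pFam hψ hθ hq hκ hst.dens₀ hst.payoff₀ (hH₀.trans ?_)
      rw [EReal.coe_eq_coe_iff]
      linarith
    refine ⟨b₀, ?_⟩
    rw [← hst.payoff₀]
    refine eInt_congr (hp₀.mono fun r hr => ?_)
    simp only [hr]
  · generalize pFam ψ X θ₁ θ₂ = q at *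
    have heq : (fun r => X r * q r) = fun r => θ₂⁻¹ * ((q r * (θ₁ + θ₂ * X r) -
        (β r (q r)).toReal) + (β r (q r)).toReal - θ₁ * q r) := by
      funext r; field_simp; ring
    refine ⟨_, eInt_coe_of_integrable ?_⟩
    rw [heq]
    exact ((hki.add hai).sub (hqi.const_mul θ₁)).const_mul _

end ConvexIntegrand

/-- Lemma on optimality, part (i). Let `(θ₁,θ₂) ∈ Θ` with
`p_{θ₁,θ₂}` a density. Then `∫ X p_{θ₁,θ₂} dμ` is finite iff `H(p_{θ₁,θ₂})` is; in that
case `p_{θ₁,θ₂}` is the unique density attaining the infimum defining `F(b)` for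
`b := ∫ X p_{θ₁,θ₂} dμ`, and `F(b) = H(p_{θ₁,θ₂}) = θ₁ + θ₂ b − K(θ₁,θ₂) = θ₂ b − G(θ₂)`;
if moreover `H(p_{θ₁,θ₂}) > 0` then `b < b₀` when `θ₂ < 0` and `b > b₀` when `θ₂ > 0`. -/
theorem optimality_part_i {Ω : Type*} [MeasurableSpace Ω] (μ : Measure Ω)
    (β : Ω → ℝ → EReal) (β' : Ω → ℝ → ℝ) (ψ : Ω → ℝ → ℝ) (X : Ω → ℝ) (p₀ : Ω → ℝ) (b₀ : ℝ)
    (hst : Standing μ β β' X p₀ b₀) (hψ : IsConjDeriv β β' ψ)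
    (θ₁ θ₂ : ℝ) (hθ : (θ₁, θ₂) ∈ ThetaSet μ β β' X)
    (hq : IsDensity μ (pFam ψ X θ₁ θ₂)) :
    ((∃ b : ℝ, xInt μ X (pFam ψ X θ₁ θ₂) = (b : EReal)) ↔
      (∃ h : ℝ, Hfun μ β (pFam ψ X θ₁ θ₂) = (h : EReal))) ∧
    ∀ b : ℝ, xInt μ X (pFam ψ X θ₁ θ₂) = (b : EReal) →
      (Ffun μ β X b = Hfun μ β (pFam ψ X θ₁ θ₂) ∧
       Ffun μ β X b = (θ₁ : EReal) + (θ₂ : EReal) * (b : EReal) - Kfun μ β X θ₁ θ₂ ∧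
       Ffun μ β X b = (θ₂ : EReal) * (b : EReal) - Gfun μ β X θ₂ ∧
       (∀ p : Ω → ℝ, IsDensity μ p → xInt μ X p = (b : EReal) →
          Hfun μ β p = Ffun μ β X b → p =ᵐ[μ] pFam ψ X θ₁ θ₂) ∧
       (0 < Hfun μ β (pFam ψ X θ₁ θ₂) →
          (θ₂ < 0 → b < b₀) ∧ (0 < θ₂ → b₀ < b))) := by
  have hH₀ : Hfun μ β p₀ = ((0 : ℝ) : EReal) := by simpa using hst.H₀
  obtain ⟨κ, hκ⟩ := hst.exists_Kfun_eq_coe hθ.1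
  refine ⟨⟨fun ⟨b, hb⟩ => ⟨_, hst.Hfun_pFam hψ hθ hq hκ hb⟩,
    fun ⟨h, hh⟩ => hst.exists_xInt_pFam hψ hθ hq hκ hh⟩, fun b hb => ?_⟩
  have hH := hst.Hfun_pFam hψ hθ hq hκ hb
  have hF : Ffun μ β X b = Hfun μ β (pFam ψ X θ₁ θ₂) := by
    refine le_antisymm (iInf_le (fun p : {p : Ω → ℝ // IsDensity μ p ∧ xInt μ X p = (b : EReal)} =>
      Hfun μ β p.1) ⟨_, hq, hb⟩) (le_iInf fun ⟨p, hp, hpb⟩ => ?_)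
    by_cases htop : Hfun μ β p = ⊤
    · exact htop ▸ le_top
    obtain ⟨c, hc⟩ := hst.exists_Hfun_eq_coe hp htop
    have hle := hst.le_Kfun hp hpb hc θ₁ θ₂
    rw [hκ, EReal.coe_le_coe_iff] at hle
    rw [hH, hc, EReal.coe_le_coe_iff]
    linarith
  have hG : Gfun μ β X θ₂ = ((κ - θ₁ : ℝ) : EReal) := by
    refine le_antisymm ?_ (le_iInf fun θ => ?_)
    · rw [EReal.coe_sub, ← hκ]
      exact iInf_le (fun θ : ℝ => Kfun μ β X θ θ₂ - (θ : EReal)) θ₁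
    · have hle := EReal.sub_le_sub (hst.le_Kfun hq hb hH θ θ₂) (le_refl (θ : EReal))
      rw [← EReal.coe_sub] at hle
      convert hle using 2
      ring
  refine ⟨hF, ?_, ?_, fun p hp hpb hpF => ?_, fun hpos => ?_⟩
  · rw [hF, hH, hκ]
    norm_cast
  · rw [hF, hH, hG, ← EReal.coe_mul, ← EReal.coe_sub, EReal.coe_eq_coe_iff]
    ring
  · exact hst.ae_eq_pFam hψ hθ hq hκ hp hpb (by rw [hpF, hF, hH])
  · rw [hH] at hpos
    replace hpos : 0 < θ₁ + θ₂ * b - κ := by exact_mod_cast hpos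
    have hle := hst.le_Kfun hst.dens₀ hst.payoff₀ hH₀ θ₁ θ₂
    rw [hκ, EReal.coe_le_coe_iff] at hle
    exact ⟨fun hneg => by nlinarith, fun hpos' => by nlinarith⟩
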